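/- Let n ≥ 2 and R ≥ 1, and let (M, (F_m)_{m∈ℕ}) be an R-communication bounded social choice rule for n candidates. Suppose there exist two rankings π and π' with M(π) = M(π') but π(1) ≠ π'(1), i.e., some message does not uniquely determine the voter's top-ranked candidate. Then the rule has unbounded distortion: for every real c > 0 there exist a number of voters m ≥ 1, a profile Π of rankings, and a distance function d for m voters consistent with Π, such that Σ_v d(v, F_m(M∘Π)) ≥ c · min_{y candidate} Σ_v d(v, y). -/

import Mathlib

/-- If two rankings with different top candidates get the same message, then some profile and
some consistent distance function give cost zero to one candidate and positive cost to the
elected one. -/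
theorem exists_profile_zero_cost_and_pos_winner_cost {n R : ℕ} (t : Fin n) (ht : ∀ i, t ≤ i)
    (M : (Fin n ≃ Fin n) → Fin R) (F : ∀ m : ℕ, (Fin m → Fin R) → Fin n)
    (π π' : Fin n ≃ Fin n) (hM : M π = M π') (htop : π t ≠ π' t) :
    ∃ (m : ℕ), 1 ≤ m ∧ ∃ (P : Fin m → (Fin n ≃ Fin n)) (d : Fin m → Fin n → ℝ),
      (∀ v x, 0 ≤ d v x) ∧
      (∀ v v' x y, d v y ≤ d v x + d v' x + d v' y) ∧
      (∀ (v : Fin m) (i j : Fin n), i ≤ j → d v (P v i) ≤ d v (P v j)) ∧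
      ∃ y, ∑ v, d v y = 0 ∧ 0 < ∑ v, d v (F m (fun v => M (P v))) := by
  obtain ⟨σ, hσM, hσ⟩ : ∃ σ, M σ = M π ∧ F 1 (fun _ => M π) ≠ σ t := by
    by_cases h : F 1 (fun _ => M π) = π t
    · exact ⟨π', hM.symm, h ▸ htop⟩
    · exact ⟨π, rfl, h⟩
  have hnonneg (x : Fin n) : (0 : ℝ) ≤ if x = σ t then 0 else 1 := by split_ifs <;> norm_num
  refine ⟨1, le_rfl, fun _ => σ, fun _ x => if x = σ t then 0 else 1, fun _ => hnonneg, ?_, ?_,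
    σ t, by simp, by simp [hσM, hσ]⟩
  · intro _ _ x y
    linarith [hnonneg x]
  · intro _ i j hij
    by_cases hj : j = t
    · have hi : i = t := le_antisymm (hj ▸ hij) (ht i)
      simp [hi, hj]
    · simp only [EmbeddingLike.apply_eq_iff_eq, hj, if_false]
      split_ifs <;> norm_num


/-- If some message of an `R`-communication bounded social choice rule
does not uniquely determine the voter's top-ranked candidate (two rankings with
different top candidates get the same message), the rule has unbounded distortion.
Rankings are bijections from positions `Fin n` (position `0` most preferred) to
candidates `Fin n`. -/
theorem ambiguous_top_unbounded_distortion (n R : ℕ) (hn : 2 ≤ n) (hR : 1 ≤ R)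
    (M : (Fin n ≃ Fin n) → Fin R)
    (F : ∀ m : ℕ, (Fin m → Fin R) → Fin n)
    (π π' : Fin n ≃ Fin n) (hM : M π = M π')
    (htop : π ⟨0, by omega⟩ ≠ π' ⟨0, by omega⟩)
    (c : ℝ) (hc : 0 < c) :
    ∃ (m : ℕ), 1 ≤ m ∧ ∃ (P : Fin m → (Fin n ≃ Fin n)) (d : Fin m → Fin n → ℝ),
      (∀ v x, 0 ≤ d v x) ∧
      (∀ v v' x y, d v y ≤ d v x + d v' x + d v' y) ∧
      (∀ (v : Fin m) (i j : Fin n), i ≤ j → d v (P v i) ≤ d v (P v j)) ∧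
      c * (Finset.univ.inf' ⟨(⟨0, by omega⟩ : Fin n), Finset.mem_univ _⟩
            (fun y : Fin n => ∑ v, d v y)) ≤ ∑ v, d v (F m (fun v => M (P v))) := by
  obtain ⟨m, hm, P, d, h1, h2, h3, y, hy, hpos⟩ :=
    exists_profile_zero_cost_and_pos_winner_cost ⟨0, by omega⟩ (fun i => Nat.zero_le i.val)
      M F π π' hM htop
  refine ⟨m, hm, P, d, h1, h2, h3, ?_⟩
  refine le_trans ?_ hpos.le
  refine mul_nonpos_of_nonneg_of_nonpos hc.le ?_
  exact (Finset.inf'_le _ (Finset.mem_univ y)).trans hy.le
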